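/- arXiv:1206.3066 — 7 statements merged into one kernel-verified Lean document; each statement's English description precedes it below -/
import Mathlib

section
/- Under Assumption (A), let ρ = (ρ_1,…,ρ_d) ∈ ℝ^d satisfy ρ_i > 0 and (ρP)_i ≤ ρ_i for all i = 1,…,d. Then the vector ρ̃ = (ρ̃_1,…,ρ̃_d) with ρ̃_i = √(ν_i ρ_i) satisfies ρ̃_i > 0 and (ρ̃P)_i ≤ ρ̃_i for all i = 1,…,d. -/
open scoped BigOperators
open Filter

/-- The `i`-th standard unit vector in `ℤ^d`. -/
def unitZ {d : ℕ} (i : Fin d) : Fin d → ℤ := fun k => if k = i then 1 else 0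

/-- The jump rates `q(y)` of the Jackson network: `q(ε^i) = λ_i`,
`q(-ε^i) = μ_i p_{i0}`, `q(ε^j - ε^i) = μ_i p_{ij}` and `q(y) = 0` otherwise. -/
noncomputable def qrate {d : ℕ} (lam mu : Fin d → ℝ) (P : Fin d → Fin d → ℝ)
    (y : Fin d → ℤ) : ℝ :=
  (∑ i, lam i * (if y = unitZ i then 1 else 0))
    + (∑ i, mu i * (1 - ∑ j, P i j) * (if y = -unitZ i then 1 else 0))
    + (∑ i, ∑ j, mu i * P i j * (if y = unitZ j - unitZ i then 1 else 0))

/-- Assumption (A): irreducibility of the matrix `(q(x - y); x, y ∈ ℤ^d)`. -/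
def AssumptionA {d : ℕ} (lam mu : Fin d → ℝ) (P : Fin d → Fin d → ℝ) : Prop :=
  ∀ x y : Fin d → ℤ, ∃ (n : ℕ) (c : Fin (n + 1) → Fin d → ℤ),
    c 0 = x ∧ c (Fin.last n) = y ∧
      ∀ k : Fin n, 0 < qrate lam mu P (c k.succ - c k.castSucc)

/-- The generator `ℒ` of the Jackson network:
`(ℒ f)(x) = ∑_{z ∈ ℤ_+^d} q(z - x) (f z - f x)`. -/
noncomputable def gen {d : ℕ} (lam mu : Fin d → ℝ) (P : Fin d → Fin d → ℝ)
    (f : (Fin d → ℕ) → ℝ) (x : Fin d → ℕ) : ℝ :=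
  ∑' z : Fin d → ℕ, qrate lam mu P (fun k => (z k : ℤ) - (x k : ℤ)) * (f z - f x)

/-- The hitting-probability matrix `Q j i = G j i / G i i`. -/
noncomputable def hitQ {d : ℕ} (G : Fin d → Fin d → ℝ) : Fin d → Fin d → ℝ :=
  fun j i => G j i / G i i

/-- The vector `γ⃗_i`, with components `γ_i^j = log (1 + Q j i * γ i)`. -/
noncomputable def gvec {d : ℕ} (Q : Fin d → Fin d → ℝ) (γ : Fin d → ℝ) (i j : Fin d) : ℝ :=
  Real.log (1 + Q j i * γ i)

/-- The set `Γ`: all `γ ∈ ℝ_+^d` such that for every `i` and every nonzero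
`v ∈ ℝ_+^d` with `v i = 0` one has `γ⃗_i ⬝ v < max_j γ⃗_j ⬝ v`. -/
def GammaSet (d : ℕ) (Q : Fin d → Fin d → ℝ) : Set (Fin d → ℝ) :=
  {γ | (∀ i, 0 ≤ γ i) ∧
    ∀ i : Fin d, ∀ v : Fin d → ℝ, (∀ j, 0 ≤ v j) → v ≠ 0 → v i = 0 →
      (∑ j, gvec Q γ i j * v j) < ⨆ l : Fin d, ∑ j, gvec Q γ l j * v j}

/-- The geometric mean of two nonnegative `P`-excessive vectors is `P`-excessive. -/
theorem sum_sqrt_mul_mul_le {ι : Type*} [Fintype ι] {P : ι → ι → ℝ} {u v : ι → ℝ} {i : ι}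
    (hP : ∀ j, 0 ≤ P j i) (hu : ∀ j, 0 ≤ u j) (hv : ∀ j, 0 ≤ v j)
    (hui : ∑ j, u j * P j i ≤ u i) (hvi : ∑ j, v j * P j i ≤ v i) :
    ∑ j, √(u j * v j) * P j i ≤ √(u i * v i) :=
  calc
    ∑ j, √(u j * v j) * P j i = ∑ j, √(u j * P j i) * √(v j * P j i) := by
      refine Finset.sum_congr rfl fun j _ => ?_
      rw [Real.sqrt_mul (hu j), Real.sqrt_mul (hu j), Real.sqrt_mul (hv j), mul_mul_mul_comm,
        Real.mul_self_sqrt (hP j)]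
    _ ≤ √(∑ j, u j * P j i) * √(∑ j, v j * P j i) :=
      Real.sum_sqrt_mul_sqrt_le _ (fun j => mul_nonneg (hu j) (hP j))
        (fun j => mul_nonneg (hv j) (hP j))
    _ ≤ √(u i) * √(v i) := by gcongr
    _ = √(u i * v i) := (Real.sqrt_mul (hu i) _).symm

/-- If ρ is positive with (ρP)_i ≤ ρ_i for all i, then ρ̃_i = √(ν_i ρ_i) is positive
and satisfies (ρ̃P)_i ≤ ρ̃_i for all i. -/
theorem stmt10
    (d : ℕ) (hd : 0 < d)
    (lam mu : Fin d → ℝ) (P : Fin d → Fin d → ℝ)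
    (hlam : ∀ i, 0 ≤ lam i) (hmu : ∀ i, 0 < mu i)
    (hP : ∀ i j, 0 ≤ P i j) (hPdiag : ∀ i, P i i = 0) (hP0 : ∀ i, ∑ j, P i j ≤ 1)
    (hA : AssumptionA lam mu P)
    (G : Fin d → Fin d → ℝ)
    (hG1 : ∀ i k, ∑ j, G i j * ((if j = k then (1 : ℝ) else 0) - P j k)
      = if i = k then 1 else 0)
    (hG2 : ∀ i k, ∑ j, ((if i = j then (1 : ℝ) else 0) - P i j) * G j k
      = if i = k then 1 else 0)
    (hGnn : ∀ i j, 0 ≤ G i j) (hGdiag : ∀ i, 1 ≤ G i i)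
    (ν : Fin d → ℝ) (hν : ∀ j, ν j = lam j + ∑ i, ν i * P i j) (hνpos : ∀ i, 0 < ν i)
    (ρ : Fin d → ℝ) (hρpos : ∀ i, 0 < ρ i) (hρ : ∀ i, ∑ j, ρ j * P j i ≤ ρ i) :
    ∀ i : Fin d, 0 < Real.sqrt (ν i * ρ i)
      ∧ ∑ j, Real.sqrt (ν j * ρ j) * P j i ≤ Real.sqrt (ν i * ρ i) := by
  intro i
  have hνi : ∑ j, ν j * P j i ≤ ν i := by linarith [hν i, hlam i]
  exact ⟨Real.sqrt_pos.2 (mul_pos (hνpos i) (hρpos i)),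
    sum_sqrt_mul_mul_le (fun j => hP j i) (fun j => (hνpos j).le) (fun j => (hρpos j).le) hνi
      (hρ i)⟩
end

section
/- Let μ_1,…,μ_d and ν_1,…,ν_d be real numbers with 0 < ν_i < μ_i for all i. Suppose there exists i_0 ∈ {1,…,d} such that min_{1≤i≤d} (√μ_i − √ν_i) = √μ_{i_0} − √ν_{i_0} and min_{1≤i≤d} (μ_i/√μ_{i_0} − ν_i/√ν_{i_0}) = √μ_{i_0} − √ν_{i_0}. Then sup_{t>0} min_{1≤i≤d} t (μ_i/(1+t) − ν_i) = min_{1≤i≤d} (√μ_i − √ν_i)². In particular, such an i_0 exists (and hence the equality holds) if either μ_i/ν_i = μ_j/ν_j for all i,j, or there is i_0 with μ_i ≥ μ_{i_0} and ν_i ≤ ν_{i_0} for all i. -/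
open scoped BigOperators
open Filter

theorem ciInf_eq_apply_of_forall_le {ι : Type*} {f : ι → ℝ} {i₀ : ι}
    (h : ∀ i, f i₀ ≤ f i) : ⨅ i, f i = f i₀ :=
  (show IsLeast (Set.range f) (f i₀) from
    ⟨⟨i₀, rfl⟩, by rintro _ ⟨i, rfl⟩; exact h i⟩).csInf_eq

theorem mul_div_one_add_sub_le_sq (a b : ℝ) {t : ℝ} (ht : 0 < t) :
    t * (a ^ 2 / (1 + t) - b ^ 2) ≤ (a - b) ^ 2 := by
  have h1 : 0 < 1 + t := by linarith
  have key : (a - b) ^ 2 - t * (a ^ 2 / (1 + t) - b ^ 2) = (a - b * (1 + t)) ^ 2 / (1 + t) := by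
    field_simp
    ring
  have : 0 ≤ (a - b * (1 + t)) ^ 2 / (1 + t) := by positivity
  linarith

theorem sSup_iInf_eq_of_forall_le {ι : Type*} [Finite ι] {a b : ι → ℝ} {i₀ : ι}
    (hb : 0 < b i₀) (hab : b i₀ < a i₀) (h₁ : ∀ i, a i₀ - b i₀ ≤ a i - b i)
    (h₂ : ∀ i, a i₀ - b i₀ ≤ a i ^ 2 / a i₀ - b i ^ 2 / b i₀) :
    sSup ((fun t : ℝ => ⨅ i, t * (a i ^ 2 / (1 + t) - b i ^ 2)) '' Set.Ioi 0)
      = ⨅ i, (a i - b i) ^ 2 := by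
  have ha : 0 < a i₀ := hb.trans hab
  have hpos : 0 < a i₀ - b i₀ := sub_pos.2 hab
  rw [ciInf_eq_apply_of_forall_le (f := fun i => (a i - b i) ^ 2) (i₀ := i₀)
    fun i => pow_le_pow_left₀ hpos.le (h₁ i) 2]
  have hub : ∀ t : ℝ, 0 < t →
      ⨅ i, t * (a i ^ 2 / (1 + t) - b i ^ 2) ≤ (a i₀ - b i₀) ^ 2 := fun t ht =>
    (ciInf_le (Set.finite_range _).bddBelow i₀).trans (mul_div_one_add_sub_le_sq _ _ ht)
  have ht : 0 < a i₀ / b i₀ - 1 := sub_pos.2 ((one_lt_div hb).2 hab)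
  refine IsGreatest.csSup_eq
    ⟨⟨a i₀ / b i₀ - 1, ht, le_antisymm (hub _ ht) ?_⟩, ?_⟩
  · have : Nonempty ι := ⟨i₀⟩
    refine le_ciInf fun i => ?_
    have key : (a i₀ / b i₀ - 1) * (a i ^ 2 / (1 + (a i₀ / b i₀ - 1)) - b i ^ 2)
        = (a i₀ - b i₀) * (a i ^ 2 / a i₀ - b i ^ 2 / b i₀) := by
      rw [add_sub_cancel]
      field_simp
    rw [key, sq]
    exact mul_le_mul_of_nonneg_left (h₂ i) hpos.le
  · rintro _ ⟨t, ht, rfl⟩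
    exact hub t ht

/-- If all ratios `a i / b i` agree, an index minimizing `b` attains both minima. -/
theorem exists_forall_le_of_div_eq {ι : Type*} [Finite ι] [Nonempty ι] {a b : ι → ℝ}
    (hb : ∀ i, 0 < b i) (hab : ∀ i, b i < a i) (h : ∀ i j, a i / b i = a j / b j) :
    ∃ i₀, (∀ i, a i₀ - b i₀ ≤ a i - b i) ∧
      ∀ i, a i₀ - b i₀ ≤ a i ^ 2 / a i₀ - b i ^ 2 / b i₀ := by
  obtain ⟨i₀, hi₀⟩ := Finite.exists_min b
  obtain ⟨s, hs⟩ : ∃ s, s = a i₀ / b i₀ := ⟨_, rfl⟩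
  have ha : ∀ i, a i = s * b i := fun i => by
    rw [hs, ← h i i₀, div_mul_cancel₀ _ (hb i).ne']
  have hs1 : 1 < s := hs ▸ (one_lt_div (hb i₀)).2 (hab i₀)
  have hb₀ := hb i₀
  refine ⟨i₀, fun i => ?_, fun i => ?_⟩
  · rw [ha, ha i]
    nlinarith [hi₀ i]
  · have key : a i ^ 2 / a i₀ - b i ^ 2 / b i₀ = (s - 1) * (b i ^ 2 / b i₀) := by
      rw [ha, ha i₀]
      field_simp
    have hle : b i₀ ≤ b i ^ 2 / b i₀ := by
      rw [le_div_iff₀ hb₀]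
      nlinarith [hi₀ i]
    rw [key, ha i₀]
    nlinarith

/-- An index minimizing `a` and maximizing `b` attains both minima. -/
theorem forall_le_of_forall_le_and_le {ι : Type*} {a b : ι → ℝ} {i₀ : ι}
    (ha : 0 < a i₀) (hb : ∀ i, 0 < b i) (h : ∀ i, a i₀ ≤ a i ∧ b i ≤ b i₀) :
    (∀ i, a i₀ - b i₀ ≤ a i - b i) ∧
      ∀ i, a i₀ - b i₀ ≤ a i ^ 2 / a i₀ - b i ^ 2 / b i₀ := by
  refine ⟨fun i => sub_le_sub (h i).1 (h i).2, fun i => sub_le_sub ?_ ?_⟩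
  · rw [le_div_iff₀ ha]
    nlinarith [(h i).1]
  · rw [div_le_iff₀ (hb i₀)]
    nlinarith [(h i).2, hb i]

/-- Corollary 3.3 (abstract form): if 0 < ν_i < μ_i for all i and there is i_0 with
min_i (√μ_i - √ν_i) = √μ_{i_0} - √ν_{i_0} and
min_i (μ_i/√μ_{i_0} - ν_i/√ν_{i_0}) = √μ_{i_0} - √ν_{i_0}, then
sup_{t>0} min_i t (μ_i/(1+t) - ν_i) = min_i (√μ_i - √ν_i)².  In particular such an
i_0 exists (and the equality holds) if μ_i/ν_i is independent of i, or if there is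
i_0 with μ_i ≥ μ_{i_0} and ν_i ≤ ν_{i_0} for all i. -/
theorem stmt13 (d : ℕ) (hd : 0 < d) (mu ν : Fin d → ℝ)
    (hνpos : ∀ i, 0 < ν i) (hB : ∀ i, ν i < mu i) :
    (∀ i0 : Fin d,
        (⨅ i : Fin d, (Real.sqrt (mu i) - Real.sqrt (ν i)))
            = Real.sqrt (mu i0) - Real.sqrt (ν i0) →
        (⨅ i : Fin d, (mu i / Real.sqrt (mu i0) - ν i / Real.sqrt (ν i0)))
            = Real.sqrt (mu i0) - Real.sqrt (ν i0) →
        sSup ((fun t : ℝ => ⨅ i : Fin d, t * (mu i / (1 + t) - ν i)) '' Set.Ioi 0)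
          = ⨅ i : Fin d, (Real.sqrt (mu i) - Real.sqrt (ν i)) ^ 2)
    ∧ (((∀ i j : Fin d, mu i / ν i = mu j / ν j)
          ∨ ∃ i0 : Fin d, ∀ i, mu i0 ≤ mu i ∧ ν i ≤ ν i0) →
        (∃ i0 : Fin d,
          (⨅ i : Fin d, (Real.sqrt (mu i) - Real.sqrt (ν i)))
              = Real.sqrt (mu i0) - Real.sqrt (ν i0)
          ∧ (⨅ i : Fin d, (mu i / Real.sqrt (mu i0) - ν i / Real.sqrt (ν i0)))
              = Real.sqrt (mu i0) - Real.sqrt (ν i0))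
        ∧ sSup ((fun t : ℝ => ⨅ i : Fin d, t * (mu i / (1 + t) - ν i)) '' Set.Ioi 0)
            = ⨅ i : Fin d, (Real.sqrt (mu i) - Real.sqrt (ν i)) ^ 2) := by
  obtain ⟨a, ha⟩ : ∃ a : Fin d → ℝ, ∀ i, √(mu i) = a i := ⟨_, fun _ => rfl⟩
  obtain ⟨b, hb⟩ : ∃ b : Fin d → ℝ, ∀ i, √(ν i) = b i := ⟨_, fun _ => rfl⟩
  have hmu : ∀ i, mu i = a i ^ 2 := fun i => by
    rw [← ha, Real.sq_sqrt ((hνpos i).trans (hB i)).le]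
  have hν : ∀ i, ν i = b i ^ 2 := fun i => by rw [← hb, Real.sq_sqrt (hνpos i).le]
  have hbpos : ∀ i, 0 < b i := fun i => hb i ▸ Real.sqrt_pos.2 (hνpos i)
  have hab : ∀ i, b i < a i := fun i =>
    ha i ▸ hb i ▸ Real.sqrt_lt_sqrt (hνpos i).le (hB i)
  have hapos : ∀ i, 0 < a i := fun i => (hbpos i).trans (hab i)
  simp only [ha, hb]
  simp only [hmu, hν]
  constructor
  · intro i₀ h₁ h₂
    exact sSup_iInf_eq_of_forall_le (hbpos i₀) (hab i₀)
      (fun i => h₁ ▸ ciInf_le (Set.finite_range _).bddBelow i)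
      (fun i => h₂ ▸ ciInf_le (Set.finite_range fun i => a i ^ 2 / a i₀ - b i ^ 2 / b i₀).bddBelow i)
  · intro h
    obtain ⟨i₀, h₁, h₂⟩ : ∃ i₀, (∀ i, a i₀ - b i₀ ≤ a i - b i) ∧
        ∀ i, a i₀ - b i₀ ≤ a i ^ 2 / a i₀ - b i ^ 2 / b i₀ := by
      rcases h with h | ⟨i₀, h⟩
      · have : Nonempty (Fin d) := ⟨⟨0, hd⟩⟩
        refine exists_forall_le_of_div_eq hbpos hab fun i j => ?_
        rw [← sq_eq_sq₀ (div_pos (hapos i) (hbpos i)).le (div_pos (hapos j) (hbpos j)).le,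
          div_pow, div_pow]
        exact h i j
      · exact ⟨i₀, forall_le_of_forall_le_and_le (hapos i₀) hbpos fun i =>
          ⟨(sq_le_sq₀ (hapos i₀).le (hapos i).le).1 (h i).1,
            (sq_le_sq₀ (hbpos i).le (hbpos i₀).le).1 (h i).2⟩⟩
    have hi₀ : a i₀ ^ 2 / a i₀ - b i₀ ^ 2 / b i₀ = a i₀ - b i₀ := by
      rw [sq, sq, mul_self_div_self, mul_self_div_self]
    refine ⟨⟨i₀, ciInf_eq_apply_of_forall_le (f := fun i => a i - b i) h₁, ?_⟩,
      sSup_iInf_eq_of_forall_le (hbpos i₀) (hab i₀) h₁ h₂⟩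
    rw [← hi₀]
    exact ciInf_eq_apply_of_forall_le (f := fun i => a i ^ 2 / a i₀ - b i ^ 2 / b i₀)
      fun i => hi₀.trans_le (h₂ i)
end

section
/- Consider a completely symmetric Jackson network (p_{ij} = p for all i ≠ j, 0 < p < 1/(d−1)) satisfying Assumptions (A) and (B), and assume: (i) d > 3; (ii) λ_1 + ⋯ + λ_d = 1 and 0 = λ_1 < λ_i for all i ∈ {2,…,d} (so that ν_i = (λ_i + p/(1+p−dp))/(1+p) for each i); (iii) the service rates are chosen so that √μ_i − √ν_i = t > 0 for all i (i.e. μ_i = (√ν_i + t)²). Then for every sufficiently small p > 0 there exists t_p > 0 such that for all t > t_p, the equality sup_{γ∈Γ} min_{1≤i≤d} γ_i (μ_i/(1+γ_i) − ν_i) = min_{1≤i≤d} (√μ_i − √ν_i)² fails to hold. -/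
open scoped BigOperators
open Filter

/-- Testing the defining condition of `Γ` at the index `0` and `v = (0, 1, …, 1)`. -/
theorem notMem_GammaSet_of_pow_le {e : ℕ} {q : ℝ} (hq : 0 ≤ q) {γ : Fin (e + 2) → ℝ}
    (h : ∀ k : Fin (e + 1),
      (1 + q * γ k.succ) ^ e * (1 + γ k.succ) ≤ (1 + q * γ 0) ^ (e + 1)) :
    γ ∉ GammaSet (e + 2) (fun j i => if j = i then (1 : ℝ) else q) := by
  rintro ⟨hpos, hΓ⟩
  let v : Fin (e + 2) → ℝ := Fin.cons 0 (fun _ => 1)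
  have hv0 : ∀ j, 0 ≤ v j := Fin.cases (by simp [v]) (fun j => by simp [v])
  have hv1 : v ≠ 0 := fun h0 => by simpa [v] using congrFun h0 (Fin.succ 0)
  refine (hΓ 0 v hv0 hv1 (by simp [v])).not_ge (ciSup_le fun l => ?_)
  induction l using Fin.cases with
  | zero => exact le_rfl
  | succ k =>
    have hk := hpos k.succ
    have hqk := mul_nonneg hq hk
    have hne : ∀ j : Fin e, k.succAbove j ≠ k := fun j => Fin.succAbove_ne k j
    have hlog := Real.log_le_log (by positivity) (h k)
    rw [Real.log_mul (by positivity) (by positivity), Real.log_pow, Real.log_pow] at hlog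
    rw [Fin.sum_univ_succ, Fin.sum_univ_succ (n := e + 1), Fin.sum_univ_succAbove _ k]
    simp only [v, gvec, Fin.cons_zero, Fin.cons_succ, mul_zero, mul_one, zero_add, if_true,
      one_mul, Fin.succ_ne_zero, if_false, Fin.succ_inj, hne, Finset.sum_const,
      Finset.card_univ, Fintype.card_fin, nsmul_eq_mul]
    linarith

/-- The gap between `g (μ / (1 + g) - s²)` and its maximum `t²`, where `√μ = s + t`. -/
theorem mul_div_sub_eq_sq_sub {s t g : ℝ} (hg : 0 ≤ g) :
    g * ((s + t) ^ 2 / (1 + g) - s ^ 2) = t ^ 2 - (t - s * g) ^ 2 / (1 + g) := by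
  have : 1 + g ≠ 0 := by positivity
  field_simp
  ring

theorem mul_mem_Icc_of_lt_gap {s₀ s t g : ℝ} (hs₀ : 0 < s₀) (hs : s₀ ≤ s) (ht : 0 < t)
    (hg : 0 ≤ g)
    (h : t ^ 2 - t ^ 2 * s₀ / (4 * (s₀ + 2 * t)) < g * ((s + t) ^ 2 / (1 + g) - s ^ 2)) :
    s * g ∈ Set.Icc (t / 2) (2 * t) := by
  rw [mul_div_sub_eq_sq_sub hg, sub_lt_sub_iff_left,
    div_lt_div_iff₀ (by positivity) (by positivity)] at h
  have hx : s₀ * g ≤ s * g := mul_le_mul_of_nonneg_right hs hg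
  generalize s * g = x at h hx
  have hx0 : 0 ≤ x := le_trans (by positivity) hx
  have h1 : (t - x) ^ 2 * (4 * (s₀ + 2 * t)) < t ^ 2 * (s₀ + x) := by
    nlinarith [mul_le_mul_of_nonneg_left hx (sq_nonneg t)]
  constructor
  · by_contra! hlt
    have h2 : (t / 2) ^ 2 ≤ (t - x) ^ 2 := by gcongr; linarith
    have h3 : (t / 2) ^ 2 * (4 * (s₀ + 2 * t)) ≤ (t - x) ^ 2 * (4 * (s₀ + 2 * t)) := by gcongr
    have h4 : t ^ 2 * (s₀ + x) ≤ t ^ 2 * (s₀ + 2 * t) := by gcongr; linarith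
    linarith
  · by_contra! hlt
    have h2 : (x / 2) ^ 2 ≤ (t - x) ^ 2 := by nlinarith
    have h3 : (x / 2) ^ 2 * (4 * (s₀ + 2 * t)) ≤ (t - x) ^ 2 * (4 * (s₀ + 2 * t)) := by gcongr
    have h4 : t ^ 2 * s₀ ≤ x ^ 2 * s₀ := by gcongr; linarith
    have h5 : t * (t * x) ≤ 2 * x * (t * x) := by gcongr; linarith
    linarith

theorem pow_mul_le_pow_of_small {e : ℕ} (he : 2 ≤ e) {K r t a b c : ℝ} (hK : 0 < K)
    (hr : 0 < r) (hr1 : r ≤ 1) (hrK : r * ((4 * K) ^ e * (2 * K) * 3 ^ (e + 1)) ≤ 1)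
    (ht1 : 1 ≤ 2 * r ^ 2 * K * t) (ht2 : 1 ≤ K * t)
    (ha : r * t / 3 ≤ a) (hb0 : 0 ≤ b) (hb : b ≤ 2 * r ^ 2 * K * t) (hc0 : 0 ≤ c)
    (hc : c ≤ K * t) :
    (1 + b) ^ e * (1 + c) ≤ (1 + a) ^ (e + 1) := by
  have ht : 0 < t := pos_of_mul_pos_right (zero_lt_one.trans_le ht2) hK.le
  obtain ⟨m, rfl⟩ := Nat.exists_eq_add_of_le he
  calc (1 + b) ^ (2 + m) * (1 + c)
      ≤ (2 * (2 * r ^ 2 * K * t)) ^ (2 + m) * (2 * (K * t)) := by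
        gcongr <;> linarith
    _ = (r * t / 3) ^ (2 + m + 1) *
          (r ^ m * (r * ((4 * K) ^ (2 + m) * (2 * K) * 3 ^ (2 + m + 1)))) := by
        simp only [mul_pow, div_pow, show (4 : ℝ) = 2 * 2 by norm_num]
        field_simp
        ring
    _ ≤ (r * t / 3) ^ (2 + m + 1) * 1 := by
        gcongr
        exact mul_le_one₀ (pow_le_one₀ hr.le hr1) (by positivity) hrK
    _ ≤ (1 + a) ^ (2 + m + 1) := by
        rw [mul_one]
        gcongr
        linarith

/-- Proposition 3.5: in the completely symmetric network with d > 3 queues,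
λ_1 = 0 < λ_i (i ≥ 2), Σ_i λ_i = 1, and μ_i = (√ν_i + t)², for every p > 0 small
enough there is t_p > 0 such that for all t > t_p the equality
sup_{γ ∈ Γ} min_i γ_i (μ_i/(1+γ_i) - ν_i) = min_i (√μ_i - √ν_i)² fails. -/
theorem stmt15 (d : ℕ) (hd : 3 < d) (lam : Fin d → ℝ)
    (hlam0 : lam ⟨0, by omega⟩ = 0)
    (hlampos : ∀ i : Fin d, i ≠ ⟨0, by omega⟩ → 0 < lam i)
    (hlamsum : ∑ i, lam i = 1) :
    ∃ p0 : ℝ, 0 < p0 ∧ ∀ p : ℝ, 0 < p → p < p0 →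
      ∃ tp : ℝ, 0 < tp ∧ ∀ t : ℝ, tp < t →
        -- the traffic intensities ν_i and service rates μ_i = (√ν_i + t)²
        (fun ν : Fin d → ℝ => fun μ : Fin d → ℝ =>
          -- Assumption (A) for the symmetric routing matrix and Assumption (B)
          AssumptionA lam μ (fun i j => if i = j then (0 : ℝ) else p) →
          (∀ i, ν i < μ i) →
          ¬ (sSup ((fun γ : Fin d → ℝ => ⨅ i : Fin d, γ i * (μ i / (1 + γ i) - ν i)) ''
                GammaSet d
                  (fun j i => if j = i then (1 : ℝ) else p / (1 - ((d : ℝ) - 2) * p)))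
              = ⨅ i : Fin d, (Real.sqrt (μ i) - Real.sqrt (ν i)) ^ 2))
          (fun i => (lam i + p / (1 + p - (d : ℝ) * p)) / (1 + p))
          (fun i =>
            (Real.sqrt ((lam i + p / (1 + p - (d : ℝ) * p)) / (1 + p)) + t) ^ 2) := by
  obtain ⟨e, rfl⟩ : ∃ e, d = e + 2 := ⟨d - 2, by omega⟩
  have he : 2 ≤ e := by omega
  change lam 0 = 0 at hlam0
  change ∀ i : Fin (e + 2), i ≠ 0 → 0 < lam i at hlampos
  obtain ⟨m, hm, hmlam⟩ : ∃ m : ℝ, 0 < m ∧ ∀ k : Fin (e + 1), m ≤ lam k.succ := by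
    obtain ⟨k, hk⟩ := Finite.exists_min (fun k : Fin (e + 1) => lam k.succ)
    exact ⟨_, hlampos _ (Fin.succ_ne_zero k), hk⟩
  -- `K` bounds `2 / √νᵢ` for `i ≠ 0`.
  obtain ⟨K, hK, hKm⟩ : ∃ K : ℝ, 0 < K ∧ ∀ x, m / 2 ≤ x → 2 ≤ K * √x := by
    refine ⟨2 / √(m / 2), by positivity, fun x hx => ?_⟩
    rw [div_mul_eq_mul_div, le_div_iff₀ (by positivity)]
    gcongr
  set C : ℝ := (4 * K) ^ e * (2 * K) * 3 ^ (e + 1)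
  have hCpos : 0 < C := by positivity
  refine ⟨min (1 / (2 * (e + 2))) (1 / C ^ 2), by positivity, fun p hp hplt => ?_⟩
  obtain ⟨hp1, hp2⟩ := lt_min_iff.1 hplt
  rw [lt_div_iff₀ (by positivity)] at hp1 hp2
  have he0 : (0 : ℝ) ≤ e := Nat.cast_nonneg e
  have hep : 0 ≤ e * p := by positivity
  have hple : p ≤ 1 := by nlinarith
  obtain ⟨r, hr, rfl⟩ : ∃ r : ℝ, 0 < r ∧ p = r ^ 2 :=
    ⟨√p, by positivity, (Real.sq_sqrt hp.le).symm⟩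
  have hr1 : r ≤ 1 := by nlinarith
  have hrC : r * C ≤ 1 := by nlinarith [mul_pos hr hCpos]
  refine ⟨1 / (2 * r ^ 2 * K) + 1 / K, by positivity, fun t ht _ _ => ?_⟩
  have htK1 : 1 / (2 * r ^ 2 * K) < t := lt_of_le_of_lt (by simp [hK.le]) ht
  have htK2 : 1 / K < t := lt_of_le_of_lt (le_add_of_nonneg_left (by positivity)) ht
  have ht0 : 0 < t := lt_trans (by positivity) htK2
  rw [div_lt_iff₀ (by positivity)] at htK1 htK2
  push_cast at *
  set w : ℝ := r ^ 2 / (1 + r ^ 2 - (e + 2) * r ^ 2) with hw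
  have hden : 1 / 2 ≤ 1 + r ^ 2 - (e + 2) * r ^ 2 := by nlinarith
  have hwpos : 0 < w := div_pos hp (by linarith)
  have hwle : w ≤ 2 * r ^ 2 := by
    rw [hw, div_le_iff₀ (by linarith)]
    nlinarith
  set q : ℝ := r ^ 2 / (1 - ((e + 2 : ℝ) - 2) * r ^ 2) with hq
  have hdenq : 1 / 2 ≤ 1 - ((e + 2 : ℝ) - 2) * r ^ 2 := by nlinarith
  have hqge : r ^ 2 ≤ q := by
    rw [hq, le_div_iff₀ (by linarith)]
    nlinarith
  have hqle : q ≤ 2 * r ^ 2 := by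
    rw [hq, div_le_iff₀ (by linarith)]
    nlinarith
  set ν : Fin (e + 2) → ℝ := fun i => (lam i + w) / (1 + r ^ 2) with hν
  have hlam : ∀ i, 0 ≤ lam i := Fin.cases hlam0.ge fun k => hm.le.trans (hmlam k)
  have hνpos : ∀ i, 0 < ν i := fun i => div_pos (by linarith [hlam i]) (by positivity)
  have hν0 : ∀ i, ν 0 ≤ ν i := fun i => by
    simp only [hν, hlam0]
    gcongr
    exact hlam i
  have hν0le : ν 0 ≤ 2 * r ^ 2 := by
    simp only [hν, hlam0]
    rw [div_le_iff₀ (by positivity)]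
    nlinarith
  have hνge : ∀ k : Fin (e + 1), m / 2 ≤ ν k.succ := fun k => by
    simp only [hν]
    rw [le_div_iff₀ (by positivity)]
    nlinarith [hmlam k]
  have hs : ∀ i, 0 < √(ν i) := fun i => Real.sqrt_pos.2 (hνpos i)
  change ¬ (_ = ⨅ i, (√((√(ν i) + t) ^ 2) - √(ν i)) ^ 2)
  have hrhs : ⨅ i, (√((√(ν i) + t) ^ 2) - √(ν i)) ^ 2 = t ^ 2 := by
    have : ∀ i, (√((√(ν i) + t) ^ 2) - √(ν i)) ^ 2 = t ^ 2 := fun i => by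
      rw [Real.sqrt_sq (by linarith [hs i])]
      ring
    simp only [this, ciInf_const]
  rw [hrhs]
  have hs0 := hs 0
  set δ : ℝ := t ^ 2 * √(ν 0) / (4 * (√(ν 0) + 2 * t)) with hδ
  have hδpos : 0 < δ := by positivity
  have hδle : δ ≤ t ^ 2 := by
    rw [hδ, div_le_iff₀ (by positivity)]
    gcongr
    linarith
  refine (lt_of_le_of_lt (Real.sSup_le ?_ (sub_nonneg.2 hδle)) (sub_lt_self _ hδpos)).ne
  rintro _ ⟨γ, hγ, rfl⟩
  by_contra! hlt
  change t ^ 2 - δ < ⨅ i, γ i * ((√(ν i) + t) ^ 2 / (1 + γ i) - ν i) at hlt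
  have hγ0 := hγ.1
  have hIcc : ∀ i, √(ν i) * γ i ∈ Set.Icc (t / 2) (2 * t) := fun i => by
    refine mul_mem_Icc_of_lt_gap hs0 (Real.sqrt_le_sqrt (hν0 i)) ht0 (hγ0 i) ?_
    rw [Real.sq_sqrt (hνpos i).le]
    exact hlt.trans_le (ciInf_le (Set.finite_range _).bddBelow i)
  refine notMem_GammaSet_of_pow_le (hp.le.trans hqge) (fun k => ?_) hγ
  have hk := hγ0 k.succ
  have hkK : γ k.succ ≤ K * t := by
    have h1 := mul_le_mul_of_nonneg_right (hKm _ (hνge k)) hk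
    have h2 := mul_le_mul_of_nonneg_left (hIcc k.succ).2 hK.le
    linarith
  refine pow_mul_le_pow_of_small he hK hr hr1 hrC (by linarith) (by linarith) ?_
    (mul_nonneg (hp.le.trans hqge) hk) ?_ hk hkK
  · have hs0le : √(ν 0) ≤ 3 / 2 * r :=
      Real.sqrt_le_iff.2 ⟨by positivity, by rw [mul_pow]; linarith⟩
    have h1 : t / 2 ≤ 3 / 2 * r * γ 0 :=
      (hIcc 0).1.trans (mul_le_mul_of_nonneg_right hs0le (hγ0 0))
    have h2 : r ^ 2 * γ 0 ≤ q * γ 0 := mul_le_mul_of_nonneg_right hqge (hγ0 0)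
    have h3 := mul_le_mul_of_nonneg_left h1 hr.le
    linarith
  · calc q * γ k.succ ≤ 2 * r ^ 2 * (K * t) := by gcongr
      _ = 2 * r ^ 2 * K * t := by ring
end

section
/- Let d = 3 and let the routing matrix be P = [[0, p, q], [q, 0, p], [p, q, 0]] with 0 < p ≤ q and p + q < 1. Then (Id − P)^{-1} = (1/(1 − p³ − q³ − 3pq)) · [[1−pq, q²+p, p²+q], [p²+q, 1−pq, q²+p], [q²+p, p²+q, 1−pq]], the hitting-probability matrix is Q = (1/(1−pq)) · [[1−pq, q²+p, p²+q], [p²+q, 1−pq, q²+p], [q²+p, p²+q, 1−pq]], and for every t > 0 the vector γ = (t, t, t) belongs to the set Γ. -/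
open scoped BigOperators
open Filter

lemma Fin.sum_three_cyclic (f : Fin 3 → ℝ) (i : Fin 3) :
    ∑ j, f j = f i + f (i + 1) + f (i + 2) := by
  fin_cases i <;> simp [Fin.sum_univ_three] <;> ring

/-- For a cyclically symmetric hitting matrix on three nodes whose off-diagonal entries
satisfy `0 ≤ b ≤ c < 1`, every positive constant vector belongs to `Γ`. -/
lemma const_mem_GammaSet_of_cyclic (Q : Fin 3 → Fin 3 → ℝ) {b c t : ℝ} (hb : 0 ≤ b)
    (hbc : b ≤ c) (hc : c < 1) (h0 : ∀ i, Q i i = 1) (h1 : ∀ i, Q (i + 1) i = c)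
    (h2 : ∀ i, Q (i + 2) i = b) (ht : 0 < t) : (fun _ => t) ∈ GammaSet 3 Q := by
  refine ⟨fun _ => ht.le, fun i v hv hv0 hvi => ?_⟩
  have hbt : 0 ≤ b * t := by positivity
  have hBC : Real.log (1 + b * t) ≤ Real.log (1 + c * t) :=
    Real.log_le_log (by linarith) (by nlinarith)
  have hCA : Real.log (1 + c * t) < Real.log (1 + 1 * t) :=
    Real.log_lt_log (by nlinarith) (by nlinarith)
  have h21 : Q (i + 2) (i + 1) = c := by
    rw [← h1 (i + 1), add_assoc]; rfl
  have h12 : Q (i + 1) (i + 2) = b := by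
    rw [← h2 (i + 2), add_assoc]; congr 1
  have bdd : BddAbove (Set.range fun l : Fin 3 => ∑ j, gvec Q (fun _ => t) l j * v j) :=
    (Set.finite_range _).bddAbove
  rcases (hv (i + 1)).lt_or_eq with hx | hx
  · refine lt_of_lt_of_le ?_ (le_ciSup bdd (i + 1))
    simp only [Fin.sum_three_cyclic _ i, gvec, hvi, h0, h1, h2, h21]
    nlinarith [mul_le_mul_of_nonneg_right hBC (hv (i + 2)), mul_lt_mul_of_pos_right hCA hx]
  · have hy : 0 < v (i + 2) := by
      refine (hv (i + 2)).lt_of_ne fun hy => hv0 ?_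
      have hsum := Fin.sum_three_cyclic v i
      rw [hvi, ← hx, ← hy, add_zero, add_zero,
        Finset.sum_eq_zero_iff_of_nonneg fun j _ => hv j] at hsum
      exact funext fun j => hsum j (Finset.mem_univ j)
    refine lt_of_lt_of_le ?_ (le_ciSup bdd (i + 2))
    simp only [Fin.sum_three_cyclic _ i, gvec, hvi, h0, h1, h2, h12, ← hx]
    nlinarith [mul_lt_mul_of_pos_right (hBC.trans_lt hCA) hy]

/-- Proposition 3.6 (computational part): for the three-node circular routing matrix
P with parameters 0 < p ≤ q, p + q < 1, the matrix (Id - P)⁻¹ and the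
hitting-probability matrix Q have the stated explicit forms, and for every t > 0
the vector γ = (t, t, t) belongs to Γ. -/
theorem stmt16 (p q : ℝ) (hp : 0 < p) (hpq : p ≤ q) (hsum : p + q < 1) :
    let P : Matrix (Fin 3) (Fin 3) ℝ := !![0, p, q; q, 0, p; p, q, 0]
    let M : Matrix (Fin 3) (Fin 3) ℝ :=
      !![1 - p * q, q ^ 2 + p, p ^ 2 + q;
         p ^ 2 + q, 1 - p * q, q ^ 2 + p;
         q ^ 2 + p, p ^ 2 + q, 1 - p * q]
    let G : Fin 3 → Fin 3 → ℝ := fun a b => (1 - P)⁻¹ a b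
    ((1 - P)⁻¹ = (1 - p ^ 3 - q ^ 3 - 3 * p * q)⁻¹ • M)
    ∧ (∀ j i : Fin 3, hitQ G j i = (1 - p * q)⁻¹ * M j i)
    ∧ (∀ t : ℝ, 0 < t → (fun _ => t) ∈ GammaSet 3 (hitQ G)) := by
  intro P M G
  have hq : 0 < q := hp.trans_le hpq
  have hD : 0 < 1 - p ^ 3 - q ^ 3 - 3 * p * q := by
    have hfac : 1 - p ^ 3 - q ^ 3 - 3 * p * q
        = (1 - (p + q)) * (1 + (p + q) + (p ^ 2 + q ^ 2 - p * q)) := by ring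
    rw [hfac]
    exact mul_pos (by linarith) (by nlinarith [sq_nonneg (p - q), mul_pos hp hq])
  have hN : 0 < 1 - p * q := by nlinarith
  have hinv : (1 - P)⁻¹ = (1 - p ^ 3 - q ^ 3 - 3 * p * q)⁻¹ • M := by
    apply Matrix.inv_eq_right_inv
    rw [Matrix.mul_smul, inv_smul_eq_iff₀ hD.ne']
    ext i j
    fin_cases i <;> fin_cases j <;>
      simp [P, M, Matrix.mul_apply, Fin.sum_univ_three, Matrix.one_apply] <;> ring
  have hQ : ∀ j i : Fin 3, hitQ G j i = (1 - p * q)⁻¹ * M j i := by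
    intro j i
    have hMi : M i i = 1 - p * q := by fin_cases i <;> rfl
    simp only [hitQ, G, hinv, Matrix.smul_apply, smul_eq_mul, hMi]
    rw [mul_div_mul_left _ _ (inv_ne_zero hD.ne'), div_eq_inv_mul]
  refine ⟨hinv, hQ, fun t ht => ?_⟩
  refine const_mem_GammaSet_of_cyclic (hitQ G) (b := (1 - p * q)⁻¹ * (q ^ 2 + p))
    (c := (1 - p * q)⁻¹ * (p ^ 2 + q)) (by positivity) ?_ ?_ ?_ ?_ ?_ ht
  · exact mul_le_mul_of_nonneg_left (by nlinarith) (by positivity)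
  · rw [inv_mul_lt_one₀ hN]
    nlinarith
  · intro i
    rw [hQ, inv_mul_eq_one₀ hN.ne']
    fin_cases i <;> rfl
  · intro i
    rw [hQ]
    fin_cases i <;> rfl
  · intro i
    rw [hQ]
    fin_cases i <;> rfl
end

section
/- Under Assumption (A), for any i ∈ {1,…,d} and any real s > −1, the system of equations e^{α^i} = 1 + s and e^{α^j} = Σ_{k=1}^d p_{jk} e^{α^k} + p_{j0} for all j ∈ {1,…,d}\{i} has a unique solution α(s) = (α^1(s),…,α^d(s)) ∈ ℝ^d, given by α^j(s) = log(1 + Q_{ji} s) for all j (with Q_{ii} = 1). Moreover, for every Λ ⊆ {1,…,d}, this solution satisfies R_Λ(α(s)) = (s/G_{ii}) (ν_i − (μ_i/(1+s)) · 1_Λ(i)), where 1_Λ(i) = 1 if i ∈ Λ and 0 otherwise. -/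
open scoped BigOperators
open Filter

/-- The Laplace transform R_Λ of the jump distribution on the face Λ. -/
noncomputable def RLam {d : ℕ} (lam mu : Fin d → ℝ) (P : Fin d → Fin d → ℝ)
    (Λ : Finset (Fin d)) (α : Fin d → ℝ) : ℝ :=
  (∑ j, lam j * (Real.exp (α j) - 1))
    + ∑ j ∈ Λ, mu j *
        ((∑ k, P j k * Real.exp (α k - α j)) + (1 - ∑ k, P j k) * Real.exp (-α j) - 1)

/-- The set B_Λ of α with exp(α_i) ≤ Σ_j p_{ij} exp(α_j) + p_{i0} for all i ∉ Λ. -/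
def BLam {d : ℕ} (P : Fin d → Fin d → ℝ) (Λ : Finset (Fin d)) : Set (Fin d → ℝ) :=
  {α | ∀ i ∉ Λ, Real.exp (α i) ≤ (∑ j, P i j * Real.exp (α j)) + (1 - ∑ j, P i j)}

/-- A left inverse of `1 - P` recovers a vector from its image under `1 - P`. -/
theorem left_inverse_apply {d : ℕ} {P G : Fin d → Fin d → ℝ}
    (hG1 : ∀ i k, ∑ j, G i j * ((if j = k then (1 : ℝ) else 0) - P j k)
      = if i = k then 1 else 0) (x : Fin d → ℝ) (i : Fin d) :
    x i = ∑ j, G i j * (x j - ∑ k, P j k * x k) := by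
  have h : ∀ j, x j - ∑ k, P j k * x k
      = ∑ k, ((if j = k then (1 : ℝ) else 0) - P j k) * x k := fun j => by
    simp [sub_mul, Finset.sum_sub_distrib]
  simp_rw [h, Finset.mul_sum]
  rw [Finset.sum_comm]
  simp_rw [← mul_assoc, ← Finset.sum_mul, hG1]
  simp

/-- The columns of a right inverse of `1 - P` satisfy the renewal equation. -/
theorem right_inverse_renewal {d : ℕ} {P G : Fin d → Fin d → ℝ}
    (hG2 : ∀ i k, ∑ j, ((if i = j then (1 : ℝ) else 0) - P i j) * G j k
      = if i = k then 1 else 0) (j i : Fin d) :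
    G j i = ∑ k, P j k * G k i + if j = i then 1 else 0 := by
  have h := hG2 j i
  simp only [sub_mul, Finset.sum_sub_distrib, ite_mul, one_mul, zero_mul, Finset.sum_ite_eq,
    Finset.mem_univ, if_true] at h
  linarith

/-- Maximum principle: each column of `(1 - P)⁻¹` is maximal on the diagonal. -/
theorem green_le_diag {d : ℕ} {P G : Fin d → Fin d → ℝ}
    (hP : ∀ i j, 0 ≤ P i j) (hP0 : ∀ i, ∑ j, P i j ≤ 1)
    (hG1 : ∀ i k, ∑ j, G i j * ((if j = k then (1 : ℝ) else 0) - P j k)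
      = if i = k then 1 else 0)
    (hG2 : ∀ i k, ∑ j, ((if i = j then (1 : ℝ) else 0) - P i j) * G j k
      = if i = k then 1 else 0)
    (hGnn : ∀ i j, 0 ≤ G i j) (j i : Fin d) : G j i ≤ G i i := by
  set f : Fin d → ℝ := fun k => max (G k i - G i i) 0 with hf
  have hf0 : ∀ k, 0 ≤ f k := fun k => le_max_right _ _
  have hsub : ∀ k, f k - ∑ l, P k l * f l ≤ 0 := by
    intro k
    have hnn : 0 ≤ ∑ l, P k l * f l := Finset.sum_nonneg fun l _ => mul_nonneg (hP k l) (hf0 l)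
    refine sub_nonpos.2 (max_le ?_ hnn)
    by_cases hk : k = i
    · subst hk
      simpa using hnn
    have h1 : ∑ l, P k l * (G l i - G i i) ≤ ∑ l, P k l * f l :=
      Finset.sum_le_sum fun l _ => mul_le_mul_of_nonneg_left (le_max_left _ _) (hP k l)
    simp only [mul_sub, Finset.sum_sub_distrib, ← Finset.sum_mul] at h1
    have h2 := right_inverse_renewal hG2 k i
    rw [if_neg hk] at h2
    have h3 := mul_le_mul_of_nonneg_right (hP0 k) (hGnn i i)
    linarith
  have hfj : f j ≤ 0 := by
    rw [left_inverse_apply hG1 f j]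
    exact Finset.sum_nonpos fun k _ => mul_nonpos_of_nonneg_of_nonpos (hGnn j k) (hsub k)
  exact sub_nonpos.1 ((le_max_left _ _).trans hfj)

/-- The solution of the traffic equations is `ν = λ (1 - P)⁻¹`. -/
theorem traffic_eq_sum {d : ℕ} {lam ν : Fin d → ℝ} {P G : Fin d → Fin d → ℝ}
    (hG2 : ∀ i k, ∑ j, ((if i = j then (1 : ℝ) else 0) - P i j) * G j k
      = if i = k then 1 else 0)
    (hν : ∀ j, ν j = lam j + ∑ i, ν i * P i j) (i : Fin d) :
    ∑ j, lam j * G j i = ν i := by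
  have h : ∀ j, lam j = ν j - ∑ k, ν k * P k j := fun j => by linarith [hν j]
  simp_rw [h, sub_mul, Finset.sum_sub_distrib, Finset.sum_mul]
  rw [Finset.sum_comm, ← Finset.sum_sub_distrib]
  simp_rw [mul_assoc, ← Finset.mul_sum, ← mul_sub]
  have h2 : ∀ k, G k i - ∑ j, P k j * G j i = if k = i then 1 else 0 := fun k => by
    linarith [right_inverse_renewal hG2 k i]
  simp [h2]

/-- Lemma 4.1: for any i and s > -1, the system exp(α_i) = 1 + s,
exp(α_j) = Σ_k p_{jk} exp(α_k) + p_{j0} (j ≠ i) has the unique solution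
α_j = log(1 + Q_{ji} s), and for every Λ this solution satisfies
R_Λ(α(s)) = (s/G_ii)(ν_i - μ_i/(1+s)·1_Λ(i)). -/
theorem stmt17
    (d : ℕ) (hd : 0 < d)
    (lam mu : Fin d → ℝ) (P : Fin d → Fin d → ℝ)
    (hlam : ∀ i, 0 ≤ lam i) (hmu : ∀ i, 0 < mu i)
    (hP : ∀ i j, 0 ≤ P i j) (hPdiag : ∀ i, P i i = 0) (hP0 : ∀ i, ∑ j, P i j ≤ 1)
    (hA : AssumptionA lam mu P)
    (G : Fin d → Fin d → ℝ)
    (hG1 : ∀ i k, ∑ j, G i j * ((if j = k then (1 : ℝ) else 0) - P j k)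
      = if i = k then 1 else 0)
    (hG2 : ∀ i k, ∑ j, ((if i = j then (1 : ℝ) else 0) - P i j) * G j k
      = if i = k then 1 else 0)
    (hGnn : ∀ i j, 0 ≤ G i j) (hGdiag : ∀ i, 1 ≤ G i i)
    (ν : Fin d → ℝ) (hν : ∀ j, ν j = lam j + ∑ i, ν i * P i j) (hνpos : ∀ i, 0 < ν i)
    : ∀ i : Fin d, ∀ s : ℝ, -1 < s →
      (∀ α : Fin d → ℝ,
        (Real.exp (α i) = 1 + s ∧ ∀ j : Fin d, j ≠ i →
            Real.exp (α j) = (∑ k, P j k * Real.exp (α k)) + (1 - ∑ k, P j k))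
        ↔ α = fun j => Real.log (1 + hitQ G j i * s))
      ∧ ∀ Λ : Finset (Fin d),
          RLam lam mu P Λ (fun j => Real.log (1 + hitQ G j i * s))
            = s / G i i * (ν i - mu i / (1 + s) * (if i ∈ Λ then 1 else 0)) := by
  intro i s hs
  have hgi : 0 < G i i := one_pos.trans_le (hGdiag i)
  have hQi : hitQ G i i = 1 := div_self hgi.ne'
  have hQ0 : ∀ j, 0 ≤ hitQ G j i := fun j => div_nonneg (hGnn j i) hgi.le
  have hQ1 : ∀ j, hitQ G j i ≤ 1 := fun j =>
    div_le_one_of_le₀ (green_le_diag hP hP0 hG1 hG2 hGnn j i) hgi.le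
  have hpos : ∀ j, 0 < 1 + hitQ G j i * s := fun j => by
    nlinarith [mul_nonneg (hQ0 j) (neg_lt_iff_pos_add.1 hs).le, hQ1 j, hQ0 j,
      mul_nonneg (sub_nonneg.2 (hQ1 j)) (neg_lt_iff_pos_add.1 hs).le]
  have hQ : ∀ j, hitQ G j i
      = ∑ k, P j k * hitQ G k i + if j = i then 1 / G i i else 0 := fun j => by
    have h := right_inverse_renewal hG2 j i
    simp only [hitQ, ← mul_div_assoc, ← Finset.sum_div]
    rw [h]
    split_ifs <;> ring
  have hsum : ∀ j, ∑ k, P j k * (1 + hitQ G k i * s) + (1 - ∑ k, P j k)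
      = 1 + (hitQ G j i - if j = i then 1 / G i i else 0) * s := fun j => by
    simp only [mul_add, mul_one, Finset.sum_add_distrib, ← mul_assoc, ← Finset.sum_mul]
    linear_combination (-s) * hQ j
  refine ⟨fun α => ⟨?_, ?_⟩, fun Λ => ?_⟩
  · rintro ⟨hi, hj⟩
    set x : Fin d → ℝ := fun k => Real.exp (α k) - 1 with hx
    set c := x i - ∑ k, P i k * x k with hc
    have hx0 : ∀ j, x j - ∑ k, P j k * x k = if j = i then c else 0 := fun j => by
      split_ifs with h
      · rw [h]
      · have := hj j h
        simp only [hx, mul_sub, mul_one, Finset.sum_sub_distrib]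
        linarith
    have hxc : ∀ j, x j = G j i * c := fun j => by
      rw [left_inverse_apply hG1 x j]
      simp [hx0]
    have hcs : G i i * c = s := by
      rw [← hxc i]
      simp [hx, hi]
    funext j
    have hxj : Real.exp (α j) = 1 + hitQ G j i * s := by
      have h : Real.exp (α j) - 1 = G j i * c := hxc j
      rw [hitQ, ← hcs, div_mul_eq_mul_div, mul_left_comm, mul_div_cancel_left₀ _ hgi.ne']
      linarith
    rw [← hxj, Real.log_exp]
  · rintro rfl
    simp only [Real.exp_log (hpos _)]
    refine ⟨by rw [hQi, one_mul], fun j hj => ?_⟩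
    rw [hsum, if_neg hj, sub_zero]
  · have hterm : ∀ j, (∑ k, P j k * Real.exp (Real.log (1 + hitQ G k i * s)
          - Real.log (1 + hitQ G j i * s)))
        + (1 - ∑ k, P j k) * Real.exp (-Real.log (1 + hitQ G j i * s)) - 1
        = if j = i then -(s / G i i / (1 + s)) else 0 := fun j => by
      simp only [Real.exp_sub, Real.exp_neg, Real.exp_log (hpos _), ← mul_div_assoc,
        ← Finset.sum_div, ← div_eq_mul_inv, ← add_div]
      rw [hsum, div_sub_one (hpos j).ne']
      split_ifs with h
      · rw [h, hQi]
        ring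
      · ring
    have hlamsum : ∑ j, lam j * (1 + hitQ G j i * s - 1) = s / G i i * ν i := by
      rw [← traffic_eq_sum hG2 hν i, Finset.mul_sum]
      exact Finset.sum_congr rfl fun j _ => by rw [hitQ]; ring
    simp only [RLam, hterm, Real.exp_log (hpos _), hlamsum, mul_ite, mul_zero, mul_one,
      Finset.sum_ite_eq']
    split_ifs <;> ring
end

section
/- Under Assumption (A), for any γ = (γ_1,…,γ_d) ∈ ℝ_+^d and any i ∈ {1,…,d}, the function f_i : ℤ_+^d → ℝ defined by f_i(x) = exp(γ⃗_i · x) satisfies (ℒf_i)(x) = (γ_i/G_{ii}) (ν_i − 1_{{x^i > 0}} · μ_i/(1+γ_i)) · f_i(x) for every x ∈ ℤ_+^d. -/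
open scoped BigOperators
open Filter

/-- An exponential function changes by the factor `exp (g ⬝ v)` along a jump `v`; the jump
contributes to the generator at `x` exactly when it stays in the orthant. -/
theorem hasSum_exp_jump {d : ℕ} (g : Fin d → ℝ) (c : ℝ) (x : Fin d → ℕ) (v : Fin d → ℤ) :
    HasSum (fun z : Fin d → ℕ =>
      c * (if (fun k => (z k : ℤ) - (x k : ℤ)) = v then 1 else 0)
        * (Real.exp (∑ j, g j * (z j : ℝ)) - Real.exp (∑ j, g j * (x j : ℝ))))
      (c * (if ∀ k, 0 ≤ (x k : ℤ) + v k then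
        Real.exp (∑ j, g j * (x j : ℝ)) * (Real.exp (∑ j, g j * (v j : ℝ)) - 1) else 0)) := by
  split_ifs with h
  · have hz : ∀ k, (((x k : ℤ) + v k).toNat : ℤ) = x k + v k := fun k => Int.toNat_of_nonneg (h k)
    have hzR : ∀ k, ((((x k : ℤ) + v k).toNat : ℕ) : ℝ) = x k + v k := fun k => by
      exact_mod_cast congrArg (Int.cast : ℤ → ℝ) (hz k)
    convert hasSum_single (fun k => ((x k : ℤ) + v k).toNat) ?_ using 1
    · have : (fun k => ((((x k : ℤ) + v k).toNat : ℕ) : ℤ) - (x k : ℤ)) = v := by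
        funext k
        rw [hz]
        ring
      simp only [this, if_true, hzR, mul_add, Finset.sum_add_distrib, Real.exp_add]
      ring
    · intro z hne
      have : ¬ (fun k => (z k : ℤ) - (x k : ℤ)) = v := by
        rintro rfl
        apply hne
        funext k
        simp
      simp [this]
  · have h0 : ∀ z : Fin d → ℕ, ¬ (fun k => (z k : ℤ) - (x k : ℤ)) = v := by
      rintro z rfl
      apply h
      intro k
      simp
    simp only [h0, if_false, mul_zero, zero_mul]
    exact hasSum_zero

theorem sum_mul_unitZ {d : ℕ} (g : Fin d → ℝ) (i : Fin d) :
    ∑ j, g j * (unitZ i j : ℝ) = g i := by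
  simp [unitZ]

theorem add_unitZ_nonneg {d : ℕ} (x : Fin d → ℕ) (i : Fin d) :
    ∀ k, 0 ≤ (x k : ℤ) + unitZ i k := by
  intro k
  unfold unitZ
  split_ifs <;> omega

theorem add_neg_unitZ_nonneg_iff {d : ℕ} (x : Fin d → ℕ) (i : Fin d) :
    (∀ k, 0 ≤ (x k : ℤ) + (-unitZ i) k) ↔ 0 < x i := by
  constructor
  · intro h
    have := h i
    simp [unitZ] at this
    omega
  · intro h k
    simp only [Pi.neg_apply, unitZ]
    split_ifs with hk
    · subst hk
      omega
    · omega

theorem add_unitZ_sub_unitZ_nonneg_iff {d : ℕ} (x : Fin d → ℕ) {i j : Fin d} (hij : i ≠ j) :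
    (∀ k, 0 ≤ (x k : ℤ) + (unitZ j - unitZ i) k) ↔ 0 < x i := by
  constructor
  · intro h
    have := h i
    simp [unitZ, hij] at this
    omega
  · intro h k
    simp only [Pi.sub_apply, unitZ]
    split_ifs with hj hi hi <;> first | omega | (subst hi; omega)

/-- The generator acting on an exponential function whose exponents are logarithms of `a`. -/
theorem gen_exp_log {d : ℕ} (lam mu : Fin d → ℝ) (P : Fin d → Fin d → ℝ)
    (hPdiag : ∀ i, P i i = 0) (a : Fin d → ℝ) (ha : ∀ i, 0 < a i) (x : Fin d → ℕ) :
    gen lam mu P (fun y => Real.exp (∑ j, Real.log (a j) * (y j : ℝ))) x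
      = (∑ k, lam k * (a k - 1)
          + ∑ k, if 0 < x k then
              mu k / a k * ((1 - ∑ j, P k j) * (1 - a k) + ∑ j, P k j * (a j - a k)) else 0)
        * Real.exp (∑ j, Real.log (a j) * (x j : ℝ)) := by
  have key := ((hasSum_sum (s := Finset.univ) fun k _ =>
      hasSum_exp_jump (fun j => Real.log (a j)) (lam k) x (unitZ k)).add
    (hasSum_sum (s := Finset.univ) fun k _ =>
      hasSum_exp_jump (fun j => Real.log (a j)) (mu k * (1 - ∑ j, P k j)) x (-unitZ k))).add
    (hasSum_sum (s := Finset.univ) fun k _ => hasSum_sum (s := Finset.univ) fun j _ =>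
      hasSum_exp_jump (fun j => Real.log (a j)) (mu k * P k j) x (unitZ j - unitZ k))
  simp only [← Finset.sum_mul, ← add_mul] at key
  refine key.tsum_eq.trans ?_
  rw [add_assoc, ← Finset.sum_add_distrib, add_mul, Finset.sum_mul, Finset.sum_mul]
  congr 1
  · refine Finset.sum_congr rfl fun k _ => ?_
    rw [if_pos (add_unitZ_nonneg x k), sum_mul_unitZ, Real.exp_log (ha k)]
    ring
  · refine Finset.sum_congr rfl fun k _ => ?_
    have hak := (ha k).ne'
    have hneg : Real.exp (∑ j, Real.log (a j) * ((-unitZ k) j : ℤ)) = (a k)⁻¹ := by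
      simp only [Pi.neg_apply, Int.cast_neg, mul_neg, Finset.sum_neg_distrib, sum_mul_unitZ,
        Real.exp_neg, Real.exp_log (ha k)]
    have htransfer : ∀ j, mu k * P k j *
        (if ∀ l, 0 ≤ (x l : ℤ) + (unitZ j - unitZ k) l then
          Real.exp (∑ j, Real.log (a j) * (x j : ℝ)) *
            (Real.exp (∑ l, Real.log (a l) * ((unitZ j - unitZ k) l : ℤ)) - 1) else 0)
        = if 0 < x k then mu k / a k * Real.exp (∑ j, Real.log (a j) * (x j : ℝ))
            * (P k j * (a j - a k)) else 0 := by
      intro j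
      rcases eq_or_ne k j with rfl | hkj
      · simp [hPdiag]
      · simp only [add_unitZ_sub_unitZ_nonneg_iff x hkj]
        simp only [Pi.sub_apply, Int.cast_sub, mul_sub,
          Finset.sum_sub_distrib, sum_mul_unitZ, Real.exp_sub, Real.exp_log (ha _)]
        split_ifs
        · field_simp
        · simp
    simp only [htransfer, hneg, add_neg_unitZ_nonneg_iff]
    split_ifs
    · rw [← Finset.mul_sum]
      field_simp
    · simp

/-- Lemma 5.1: for any γ ∈ ℝ_+^d and any i, the function f_i(x) = exp(γ⃗_i ⋅ x)
satisfies (ℒ f_i)(x) = (γ_i/G_ii)(ν_i - 1_{x_i > 0} μ_i/(1+γ_i)) f_i(x). -/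
theorem stmt18
    (d : ℕ) (hd : 0 < d)
    (lam mu : Fin d → ℝ) (P : Fin d → Fin d → ℝ)
    (hlam : ∀ i, 0 ≤ lam i) (hmu : ∀ i, 0 < mu i)
    (hP : ∀ i j, 0 ≤ P i j) (hPdiag : ∀ i, P i i = 0) (hP0 : ∀ i, ∑ j, P i j ≤ 1)
    (hA : AssumptionA lam mu P)
    (G : Fin d → Fin d → ℝ)
    (hG1 : ∀ i k, ∑ j, G i j * ((if j = k then (1 : ℝ) else 0) - P j k)
      = if i = k then 1 else 0)
    (hG2 : ∀ i k, ∑ j, ((if i = j then (1 : ℝ) else 0) - P i j) * G j k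
      = if i = k then 1 else 0)
    (hGnn : ∀ i j, 0 ≤ G i j) (hGdiag : ∀ i, 1 ≤ G i i)
    (ν : Fin d → ℝ) (hν : ∀ j, ν j = lam j + ∑ i, ν i * P i j) (hνpos : ∀ i, 0 < ν i)
    (γ : Fin d → ℝ) (hγ : ∀ i, 0 ≤ γ i) (i : Fin d) :
    ∀ x : Fin d → ℕ,
      gen lam mu P (fun y => Real.exp (∑ j, gvec (hitQ G) γ i j * (y j : ℝ))) x
        = γ i / G i i * (ν i - (if 0 < x i then mu i / (1 + γ i) else 0))
            * Real.exp (∑ j, gvec (hitQ G) γ i j * (x j : ℝ)) := by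
  intro x
  have hGi : G i i ≠ 0 := (zero_lt_one.trans_le (hGdiag i)).ne'
  have hGii : 0 < G i i := zero_lt_one.trans_le (hGdiag i)
  set c := γ i / G i i with hc
  have ha : ∀ j, 1 + hitQ G j i * γ i = 1 + G j i * c := fun j => by
    simp only [hitQ, hc]
    ring
  have hc0 : 0 ≤ c := div_nonneg (hγ i) hGii.le
  have hpos : ∀ j, 0 < 1 + G j i * c := fun j => by
    have := mul_nonneg (hGnn j i) hc0
    linarith
  have hPG : ∀ k, ∑ j, P k j * G j i = G k i - if k = i then 1 else 0 := fun k => by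
    have := hG2 k i
    simp only [sub_mul, Finset.sum_sub_distrib, ite_mul, one_mul, zero_mul,
      Finset.sum_ite_eq, Finset.mem_univ, if_true] at this
    linarith
  have hlamG : ∑ k, lam k * G k i = ν i := by
    have hl : ∀ k, lam k * G k i = ν k * G k i - ∑ l, ν l * (P l k * G k i) := fun k => by
      have : lam k = ν k - ∑ l, ν l * P l k := by linarith [hν k]
      rw [this, sub_mul, Finset.sum_mul]
      simp only [mul_assoc]
    simp only [hl, Finset.sum_sub_distrib]
    rw [Finset.sum_comm]
    simp only [← Finset.mul_sum, hPG, mul_sub, Finset.sum_sub_distrib]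
    simp
  simp only [gvec, ha]
  rw [gen_exp_log lam mu P hPdiag (fun j => 1 + G j i * c) hpos x]
  congr 1
  have harr : ∑ k, lam k * (1 + G k i * c - 1) = c * ν i := by
    rw [← hlamG, Finset.mul_sum]
    exact Finset.sum_congr rfl fun k _ => by ring
  have hserv : ∀ k, (1 - ∑ j, P k j) * (1 - (1 + G k i * c))
      + ∑ j, P k j * (1 + G j i * c - (1 + G k i * c)) = -c * if k = i then 1 else 0 := fun k => by
    have : ∑ j, P k j * (1 + G j i * c - (1 + G k i * c))
        = (∑ j, P k j * G j i) * c - (∑ j, P k j) * (G k i * c) := by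
      rw [Finset.sum_mul, Finset.sum_mul, ← Finset.sum_sub_distrib]
      exact Finset.sum_congr rfl fun j _ => by ring
    rw [this, hPG]
    ring
  have hai : 1 + G i i * c = 1 + γ i := by
    rw [hc, mul_div_cancel₀ _ hGi]
  simp only [harr, hserv]
  rw [Finset.sum_eq_single i (fun k _ hk => by simp [hk]) (by simp), hai, if_pos rfl]
  split_ifs <;> ring
end

section
/- For vectors u_1,…,u_d ∈ ℝ^d, the following two properties are equivalent: (1) for every v ∈ ℝ_+^d \ {0} there exists i ∈ {1,…,d} such that u_i · v > 0; (2) there exists θ = (θ^1,…,θ^d) ∈ ℝ_+^d with θ^1 + ⋯ + θ^d = 1 such that every coordinate of Σ_{j=1}^d θ^j u_j is strictly positive. -/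
open scoped BigOperators
open Filter

/-- Lemma 6.1 (a Hahn–Banach separation lemma): for u_1, …, u_d ∈ ℝ^d the following
are equivalent: (1) for every nonzero v ∈ ℝ_+^d there is i with u_i ⋅ v > 0;
(2) there is a probability vector θ such that Σ_j θ^j u_j has all coordinates
strictly positive. -/
theorem stmt19 (d : ℕ) (hd : 0 < d) (u : Fin d → Fin d → ℝ) :
    (∀ v : Fin d → ℝ, (∀ k, 0 ≤ v k) → v ≠ 0 → ∃ i : Fin d, 0 < ∑ k, u i k * v k)
    ↔ ∃ θ : Fin d → ℝ, (∀ j, 0 ≤ θ j) ∧ (∑ j, θ j) = 1 ∧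
        ∀ k : Fin d, 0 < ∑ j, θ j * u j k := by
  constructor
  · intro h
    by_contra hθ
    set L := Fintype.linearCombination ℝ u
    have hL (θ : Fin d → ℝ) (k : Fin d) : L θ k = ∑ j, θ j * u j k := by
      simp [L, Fintype.linearCombination_apply]
    have hdisj : Disjoint (Set.univ.pi fun _ : Fin d => Set.Ioi (0 : ℝ))
        (L '' stdSimplex ℝ (Fin d)) := by
      rw [Set.disjoint_right]
      rintro _ ⟨θ, hθ', rfl⟩ hpos
      exact hθ ⟨θ, hθ'.1, hθ'.2, fun k => hL θ k ▸ hpos k trivial⟩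
    obtain ⟨f, c, hf, hc⟩ := geometric_hahn_banach_open
      (convex_pi fun _ _ => convex_Ioi 0)
      (isOpen_set_pi Set.finite_univ fun _ _ => isOpen_Ioi)
      ((convex_stdSimplex ℝ (Fin d)).linear_image L) hdisj
    have hcu (i : Fin d) : c ≤ f (u i) :=
      hc _ ⟨Pi.single i 1, single_mem_stdSimplex ℝ i, by
        simp [L, Fintype.linearCombination_apply_single]⟩
    have hc0 : 0 ≤ c := by
      have hlt (ε : ℝ) (hε : 0 < ε) : ε * f 1 < c := by
        have := hf (ε • 1) fun k _ => by simpa using hε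
        simpa using this
      have hlim : Tendsto (fun ε : ℝ => ε * f 1) (nhdsWithin 0 (Set.Ioi 0)) (nhds 0) := by
        have : Continuous fun ε : ℝ => ε * f 1 := by fun_prop
        simpa using (this.tendsto 0).mono_left nhdsWithin_le_nhds
      exact le_of_tendsto hlim (eventually_nhdsWithin_of_forall fun ε hε => (hlt ε hε).le)
    have hsingle (k : Fin d) : f (Pi.single k 1) ≤ 0 := by
      by_contra! hk
      have hlt (t : ℝ) (ht : 0 ≤ t) : f 1 + t * f (Pi.single k 1) < c := by
        have := hf (1 + t • Pi.single k 1) fun l _ => by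
          have : 0 ≤ (Pi.single k (1 : ℝ) : Fin d → ℝ) l :=
            (Pi.single_nonneg.2 zero_le_one : 0 ≤ (Pi.single k (1 : ℝ) : Fin d → ℝ)) l
          simp only [Set.mem_Ioi, Pi.add_apply, Pi.one_apply, Pi.smul_apply, smul_eq_mul]
          positivity
        simpa using this
      have h0 := hlt 0 le_rfl
      have h1 := hlt ((c - f 1) / f (Pi.single k 1)) (div_nonneg (by linarith) hk.le)
      rw [div_mul_cancel₀ _ hk.ne'] at h1
      linarith
    have hsum (x : Fin d → ℝ) : f x = ∑ k, x k * f (Pi.single k 1) := by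
      conv_lhs => rw [pi_eq_sum_univ' x]
      simp [map_sum]
    obtain ⟨i, hi⟩ := h (fun k => -f (Pi.single k 1)) (fun k => by linarith [hsingle k]) (by
      intro hv
      have hzero (x : Fin d → ℝ) : f x = 0 := by
        rw [hsum]
        exact Finset.sum_eq_zero fun k _ => by
          have := congrFun hv k
          simp only [Pi.zero_apply, neg_eq_zero] at this
          rw [this, mul_zero]
      have h1 := hf 1 fun _ _ => by simp
      have h2 := hcu ⟨0, hd⟩
      rw [hzero] at h1 h2
      linarith)
    have := hcu i
    rw [hsum] at this
    simp only [mul_neg, Finset.sum_neg_distrib] at hi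
    linarith
  · rintro ⟨θ, hθ, -, hpos⟩ v hv hv0
    by_contra! hneg
    obtain ⟨k, hk⟩ := Function.ne_iff.1 hv0
    have hlt : 0 < ∑ k, (∑ j, θ j * u j k) * v k :=
      Finset.sum_pos' (fun k _ => mul_nonneg (hpos k).le (hv k))
        ⟨k, Finset.mem_univ k, mul_pos (hpos k) ((hv k).lt_of_ne' hk)⟩
    have hswap : ∑ k, (∑ j, θ j * u j k) * v k = ∑ j, θ j * ∑ k, u j k * v k := by
      simp only [Finset.sum_mul, Finset.mul_sum, mul_assoc]
      exact Finset.sum_comm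
    have hle : ∑ j, θ j * ∑ k, u j k * v k ≤ 0 :=
      Finset.sum_nonpos fun j _ => mul_nonpos_of_nonneg_of_nonpos (hθ j) (hneg j)
    linarith
end
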